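/- Let ρ be a law invariant risk measure, E a Polish space, and f : E → ℝ bounded measurable. Then the map Φ : 𝓟(E) → ℝ given by Φ(μ) := ρ_μ(f) is Borel measurable (with respect to the Borel σ-field of the topology of weak convergence). Moreover, if f is bounded and continuous, then Φ is lower semicontinuous with respect to the topology of weak convergence. -/

import Mathlib

open MeasureTheory ProbabilityTheory Filter Topology
open scoped ENNReal NNReal

noncomputable section

namespace RiskDiv

/-- A bounded measurable real-valued function (a representative of an element of `L^∞`). -/
def BddMeas {E : Type*} [MeasurableSpace E] (f : E → ℝ) : Prop :=
  Measurable f ∧ ∃ M : ℝ, ∀ x, |f x| ≤ M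

/-- A (normalized, convex, monotone, cash-additive) risk measure on `L^∞(E, μ)`,
viewed as a functional on bounded measurable functions which respects a.e. equality. -/
structure IsRiskMeasure {E : Type*} [MeasurableSpace E] (μ : Measure E)
    (ρ : (E → ℝ) → ℝ) : Prop where
  mono : ∀ f g : E → ℝ, BddMeas f → BddMeas g → (∀ᵐ x ∂μ, f x ≤ g x) → ρ f ≤ ρ g
  cash : ∀ (f : E → ℝ) (c : ℝ), BddMeas f → ρ (fun x => f x + c) = ρ f + c
  norm0 : ρ (fun _ => 0) = 0
  cvx : ∀ (f g : E → ℝ) (t : ℝ), BddMeas f → BddMeas g → 0 ≤ t → t ≤ 1 →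
    ρ (fun x => t * f x + (1 - t) * g x) ≤ t * ρ f + (1 - t) * ρ g
  congr_ae : ∀ f g : E → ℝ, BddMeas f → BddMeas g → (∀ᵐ x ∂μ, f x = g x) → ρ f = ρ g

/-- Law invariance: `ρ` only depends on the distribution of its argument. -/
def LawInvariant {E : Type*} [MeasurableSpace E] (μ : Measure E) (ρ : (E → ℝ) → ℝ) : Prop :=
  ∀ f g : E → ℝ, BddMeas f → BddMeas g → μ.map f = μ.map g → ρ f = ρ g

open Classical in
/-- `ρ_μ(f) := ρ(f ∘ X)` where `X` is any random variable with law `μ` (this is well defined,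
independently of the choice of `X`, when `ρ` is law invariant). -/
def rhoMu {Ω : Type*} [MeasurableSpace Ω] (P : Measure Ω) (ρ : (Ω → ℝ) → ℝ)
    {E : Type*} [MeasurableSpace E] (μ : Measure E) (f : E → ℝ) : ℝ :=
  if h : ∃ X : Ω → E, Measurable X ∧ P.map X = μ then ρ (f ∘ h.choose) else 0

/-- The divergence induced by `ρ`:
`α(ν|μ) := sup { ∫ f dν − ρ_μ(f) : f bounded measurable } ∈ [0,∞]`. -/
def divergence {Ω : Type*} [MeasurableSpace Ω] (P : Measure Ω) (ρ : (Ω → ℝ) → ℝ)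
    {E : Type*} [MeasurableSpace E] (ν μ : Measure E) : ℝ≥0∞ :=
  ⨆ (f : E → ℝ) (_ : BddMeas f), ENNReal.ofReal ((∫ x, f x ∂ν) - rhoMu P ρ μ f)

/-- The divergence induced by `ρ` is simplified if, on `[0,1]`, the supremum defining it can be
restricted to continuous functions. -/
def Simplified {Ω : Type*} [MeasurableSpace Ω] (P : Measure Ω) (ρ : (Ω → ℝ) → ℝ) : Prop :=
  ∀ μ ν : Measure (Set.Icc (0:ℝ) 1), IsProbabilityMeasure μ → IsProbabilityMeasure ν →
    divergence P ρ ν μ =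
      ⨆ (f : (Set.Icc (0:ℝ) 1) → ℝ) (_ : Continuous f),
        ENNReal.ofReal ((∫ x, f x ∂ν) - rhoMu P ρ μ f)

lemma cont_cdf (ν : Measure ℝ) [IsProbabilityMeasure ν] [NullSingletonClass ν] :
    Continuous (cdf ν) := by
  rw [continuous_iff_continuousAt]
  intro x
  rw [(monotone_cdf ν).continuousAt_iff_leftLim_eq_rightLim, StieltjesFunction.rightLim_eq]
  apply le_antisymm ((monotone_cdf ν).leftLim_le le_rfl)
  have h := StieltjesFunction.measure_singleton (cdf ν) x
  rw [measure_cdf, measure_singleton] at h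
  have := ENNReal.ofReal_eq_zero.1 h.symm
  linarith

lemma cdf_bounds (ν : Measure ℝ) [IsProbabilityMeasure ν] [NullSingletonClass ν]
    (u : ℝ) (h0 : 0 < u) (h1 : u < 1) :
    ν {x | cdf ν x < u} ≤ ENNReal.ofReal u ∧ ENNReal.ofReal u ≤ ν {x | cdf ν x ≤ u} := by
  obtain ⟨x, hx⟩ : u ∈ Set.range (cdf ν) := by
    apply mem_range_of_exists_le_of_exists_ge (cont_cdf ν)
    · exact ((tendsto_cdf_atBot ν).eventually (ge_mem_nhds h0)).exists
    · exact ((tendsto_cdf_atTop ν).eventually (le_mem_nhds h1)).exists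
  rw [← hx, ofReal_cdf]
  constructor
  · apply measure_mono
    intro y hy
    by_contra h
    have : x ≤ y := by
      simp only [Set.mem_Iic, not_le] at h
      exact h.le
    exact absurd (monotone_cdf ν this) (not_le.2 hy)
  · apply measure_mono
    intro y hy
    exact monotone_cdf ν hy

lemma exists_unif {Ω : Type*} [MeasurableSpace Ω] [StandardBorelSpace Ω]
    (P : Measure Ω) [IsProbabilityMeasure P] [NullSingletonClass P] :
    ∃ U : Ω → unitInterval, Measurable U ∧ P.map U = volume := by
  have he := measurableEmbedding_embeddingReal Ω
  set e := embeddingReal Ω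
  set ν := P.map e with hν
  haveI : IsProbabilityMeasure ν := Measure.isProbabilityMeasure_map he.measurable.aemeasurable
  haveI : NullSingletonClass ν := ⟨fun x => by
    rw [hν, he.map_apply]
    exact (Set.subsingleton_singleton.preimage he.injective).measure_zero P⟩
  have hF : Measurable (cdf ν) := (cont_cdf ν).measurable
  let G : ℝ → unitInterval := fun x => ⟨cdf ν x, cdf_nonneg ν x, cdf_le_one ν x⟩
  have hG : Measurable G := hF.subtype_mk
  refine ⟨G ∘ e, hG.comp he.measurable, ?_⟩
  rw [← Measure.map_map hG he.measurable]
  haveI : IsProbabilityMeasure (ν.map G) := Measure.isProbabilityMeasure_map hG.aemeasurable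
  apply Measure.ext_of_Iic
  intro u
  rw [unitInterval.volume_Iic, Measure.map_apply hG measurableSet_Iic]
  have hpre : G ⁻¹' Set.Iic u = {x | cdf ν x ≤ u} := by
    ext x; rfl
  rw [hpre]
  rcases eq_or_lt_of_le u.2.2 with h1 | h1
  · rw [h1]
    simp [cdf_le_one]
  · apply le_antisymm
    · have key : ∀ v : ℝ, (u : ℝ) < v → v < 1 → ν {x | cdf ν x ≤ u} ≤ ENNReal.ofReal v := by
        intro v hv hv1
        refine le_trans (measure_mono ?_) (cdf_bounds ν v (lt_of_le_of_lt u.2.1 hv) hv1).1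
        intro x hx
        exact lt_of_le_of_lt hx hv
      have ht : Tendsto (fun v : ℝ => ENNReal.ofReal v) (𝓝[>] (u : ℝ)) (𝓝 (ENNReal.ofReal u)) :=
        (ENNReal.continuous_ofReal.tendsto _).mono_left nhdsWithin_le_nhds
      refine ge_of_tendsto ht ?_
      filter_upwards [Ioo_mem_nhdsGT h1] with v hv using key v hv.1 hv.2
    · rcases eq_or_lt_of_le u.2.1 with h0 | h0
      · rw [← h0]; simp
      · exact (cdf_bounds ν u h0 h1).2

lemma exists_law {Ω : Type*} [MeasurableSpace Ω] [StandardBorelSpace Ω]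
    (P : Measure Ω) [IsProbabilityMeasure P] [NullSingletonClass P]
    {E : Type*} [MeasurableSpace E] [StandardBorelSpace E] (μ : Measure E)
    [IsProbabilityMeasure μ] : ∃ X : Ω → E, Measurable X ∧ P.map X = μ := by
  haveI : Nonempty E := nonempty_of_isProbabilityMeasure μ
  obtain ⟨U, hU, hUl⟩ := exists_unif P
  obtain ⟨g, hg, hgl⟩ := Measure.exists_measurable_map_eq μ
  exact ⟨g ∘ U, hg.comp hU, by rw [← Measure.map_map hg hU, hUl, hgl]⟩

lemma rhoMu_eq {Ω : Type*} [MeasurableSpace Ω] [StandardBorelSpace Ω]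
    (P : Measure Ω) [IsProbabilityMeasure P] [NullSingletonClass P] (ρ : (Ω → ℝ) → ℝ)
    {E : Type*} [MeasurableSpace E] [StandardBorelSpace E] (μ : Measure E)
    [IsProbabilityMeasure μ] : ∃ X : Ω → E, Measurable X ∧ P.map X = μ ∧
      ∀ f : E → ℝ, rhoMu P ρ μ f = ρ (f ∘ X) := by
  have h := exists_law P μ
  refine ⟨h.choose, h.choose_spec.1, h.choose_spec.2, fun f => ?_⟩
  unfold rhoMu
  rw [dif_pos h]

lemma BddMeas.comp' {Ω E : Type*} [MeasurableSpace Ω] [MeasurableSpace E] {f : E → ℝ}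
    (hf : BddMeas f) {X : Ω → E} (hX : Measurable X) : BddMeas (f ∘ X) :=
  ⟨hf.1.comp hX, hf.2.imp fun _ h x => h (X x)⟩

lemma rho_lip {Ω : Type*} [MeasurableSpace Ω] {P : Measure Ω} {ρ : (Ω → ℝ) → ℝ}
    (hρ : IsRiskMeasure P ρ) {f g : Ω → ℝ} (hf : BddMeas f) (hg : BddMeas g) (c : ℝ)
    (h : ∀ x, f x ≤ g x + c) : ρ f ≤ ρ g + c := by
  rw [← hρ.cash g c hg]
  refine hρ.mono _ _ hf ⟨hg.1.add_const c, ?_⟩ (ae_of_all _ h)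
  obtain ⟨M, hM⟩ := hg.2
  exact ⟨M + |c|, fun x => (abs_add_le _ _).trans (by linarith [hM x])⟩

/-- Sublevel sets of a risk measure are convex. -/
lemma convex_sublevel {Ω : Type*} [MeasurableSpace Ω] {P : Measure Ω} {ρ : (Ω → ℝ) → ℝ}
    (hρ : IsRiskMeasure P ρ) (c : ℝ) : Convex ℝ {f : Ω → ℝ | BddMeas f ∧ ρ f ≤ c} := by
  rintro f ⟨hf, hfc⟩ g ⟨hg, hgc⟩ a b ha hb hab
  have hb' : b = 1 - a := by linarith
  subst hb'
  have heq : a • f + (1 - a) • g = fun x => a * f x + (1 - a) * g x := by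
    ext x; simp
  rw [heq]
  refine ⟨⟨(hf.1.const_mul a).add (hg.1.const_mul _), ?_⟩, ?_⟩
  · obtain ⟨M, hM⟩ := hf.2
    obtain ⟨M', hM'⟩ := hg.2
    refine ⟨a * M + (1 - a) * M', fun x => (abs_add_le _ _).trans ?_⟩
    rw [abs_mul, abs_mul, abs_of_nonneg ha, abs_of_nonneg hb]
    exact add_le_add (mul_le_mul_of_nonneg_left (hM x) ha) (mul_le_mul_of_nonneg_left (hM' x) hb)
  · refine (hρ.cvx f g a hf hg ha (by linarith)).trans ?_
    nlinarith

def clampM (M x : ℝ) : ℝ := max (-M) (min x M)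

lemma clampM_eq {M x : ℝ} (h : |x| ≤ M) : clampM M x = x := by
  have := abs_le.1 h
  simp [clampM, this.1, this.2]

lemma abs_clampM {M : ℝ} (hM : 0 ≤ M) (x : ℝ) : |clampM M x| ≤ M := by
  unfold clampM
  rw [abs_le]
  exact ⟨le_max_left _ _, max_le (by linarith) (min_le_right _ _)⟩

lemma meas_clampM (M : ℝ) : Measurable (clampM M) := by
  unfold clampM; fun_prop

/-- The mixture measure on triples `(x, y, l)` with `l` uniform. -/
def tripleLaw (ν r : Measure ℝ) (n : ℕ) : Measure (ℝ × ℝ × Fin (n + 1)) :=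
  ((n + 1 : ℕ) : ℝ≥0∞)⁻¹ •
    ∑ l : Fin (n + 1), (ν.prod r).map (fun p : ℝ × ℝ => (p.1, p.2, l))

lemma tripleLaw_map_fst (ν r : Measure ℝ) [IsProbabilityMeasure ν] [IsProbabilityMeasure r]
    (n : ℕ) : (tripleLaw ν r n).map (fun z => z.1) = ν := by
  have hm : Measurable (fun z : ℝ × ℝ × Fin (n + 1) => z.1) := by fun_prop
  unfold tripleLaw
  rw [Measure.map_smul, Measure.map_finset_sum hm.aemeasurable]
  have : ∀ l : Fin (n + 1), ((ν.prod r).map (fun p : ℝ × ℝ => (p.1, p.2, l))).map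
      (fun z : ℝ × ℝ × Fin (n + 1) => z.1) = ν := by
    intro l
    rw [Measure.map_map hm (by fun_prop)]
    have := Measure.map_fst_prod (μ := ν) (ν := r)
    rw [measure_univ, one_smul] at this
    exact this
  simp_rw [this]
  rw [Finset.sum_const, Finset.card_univ, Fintype.card_fin, ← Nat.cast_smul_eq_nsmul ℝ≥0∞, smul_smul,
    ENNReal.inv_mul_cancel (by simp) (ENNReal.natCast_ne_top _), one_smul]

def pick {n : ℕ} (k : Fin (n + 1)) (z : ℝ × ℝ × Fin (n + 1)) : ℝ :=
  if z.2.2 = k then z.2.1 else z.1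

lemma meas_pick {n : ℕ} (k : Fin (n + 1)) : Measurable (pick k) := by
  unfold pick
  refine Measurable.ite ?_ (by fun_prop) (by fun_prop)
  exact (by fun_prop : Measurable (fun z : ℝ × ℝ × Fin (n + 1) => z.2.2))
    (measurableSet_singleton k)

lemma tripleLaw_map_pick (ν r : Measure ℝ) [IsProbabilityMeasure ν] [IsProbabilityMeasure r]
    (n : ℕ) (k : Fin (n + 1)) :
    (tripleLaw ν r n).map (pick k) = ((n + 1 : ℕ) : ℝ≥0∞)⁻¹ • (r + (n : ℝ≥0∞) • ν) := by
  have hm := meas_pick k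
  unfold tripleLaw
  rw [Measure.map_smul, Measure.map_finset_sum hm.aemeasurable]
  congr 1
  have h1 : ∀ l : Fin (n + 1), ((ν.prod r).map (fun p : ℝ × ℝ => (p.1, p.2, l))).map
      (pick k) = if l = k then r else ν := by
    intro l
    rw [Measure.map_map hm (by fun_prop)]
    have h1 := Measure.map_fst_prod (μ := ν) (ν := r)
    have h2 := Measure.map_snd_prod (μ := ν) (ν := r)
    rw [measure_univ, one_smul] at h1 h2
    split_ifs with h
    · refine Eq.trans ?_ h2
      congr 1
      ext p
      simp [pick, h]
    · refine Eq.trans ?_ h1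
      congr 1
      ext p
      simp [pick, h]
  simp_rw [h1]
  rw [← Finset.add_sum_erase _ _ (Finset.mem_univ k), if_pos rfl]
  congr 1
  rw [Finset.sum_congr rfl (g := fun _ => ν)
    (fun l hl => if_neg (Finset.ne_of_mem_erase hl))]
  rw [Finset.sum_const, Finset.card_erase_of_mem (Finset.mem_univ k), Finset.card_univ,
    Fintype.card_fin, Nat.add_sub_cancel, Nat.cast_smul_eq_nsmul]

/-- Key inequality. -/
lemma key {Ω : Type*} [MeasurableSpace Ω] [StandardBorelSpace Ω]
    (P : Measure Ω) [IsProbabilityMeasure P] [NullSingletonClass P]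
    (ρ : (Ω → ℝ) → ℝ) (hρ : IsRiskMeasure P ρ) (hLI : LawInvariant P ρ)
    (X X' : Ω → ℝ) (hX : Measurable X) (hX' : Measurable X') (M : ℝ) (hM : 0 ≤ M)
    (hXM : ∀ x, |X x| ≤ M) (hXM' : ∀ x, |X' x| ≤ M) (n : ℕ)
    (h : (n : ℝ≥0∞) • P.map X ≤ ((n + 1 : ℕ) : ℝ≥0∞) • P.map X') :
    ρ X ≤ ρ X' + 2 * M / (n + 1) := by
  haveI : IsProbabilityMeasure (P.map X) := Measure.isProbabilityMeasure_map hX.aemeasurable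
  haveI : IsProbabilityMeasure (P.map X') := Measure.isProbabilityMeasure_map hX'.aemeasurable
  set ν := P.map X with hν
  set ν' := P.map X' with hν'
  haveI : IsFiniteMeasure ((n : ℝ≥0∞) • ν) := Measure.smul_finite _ (ENNReal.natCast_ne_top _)
  obtain ⟨r, hr⟩ : ∃ r : Measure ℝ, r + (n : ℝ≥0∞) • ν = ((n + 1 : ℕ) : ℝ≥0∞) • ν' :=
    ⟨_, Measure.sub_add_cancel_of_le h⟩
  haveI : IsProbabilityMeasure r := ⟨by
    have := congrArg (fun m : Measure ℝ => m Set.univ) hr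
    simp only [Measure.add_apply, Measure.smul_apply, measure_univ, smul_eq_mul, mul_one,
      Nat.cast_add, Nat.cast_one] at this
    rw [add_comm] at this
    exact (ENNReal.add_right_inj (ENNReal.natCast_ne_top n)).1 this⟩
  have hmix : ∀ k : Fin (n + 1), (tripleLaw ν r n).map (pick k) = ν' := by
    intro k
    rw [tripleLaw_map_pick, hr, smul_smul,
      ENNReal.inv_mul_cancel (by simp) (ENNReal.natCast_ne_top _), one_smul]
  haveI : IsProbabilityMeasure (tripleLaw ν r n) := by
    rw [← Measure.isProbabilityMeasure_map_iff (f := pick (0 : Fin (n + 1)))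
      (meas_pick _).aemeasurable, hmix]
    infer_instance
  obtain ⟨Z, hZ, hZl⟩ := exists_law P (tripleLaw ν r n)
  have hclamp : ∀ (V W : Ω → ℝ), Measurable V → Measurable W → (∀ x, |W x| ≤ M) →
      P.map V = P.map W → BddMeas (clampM M ∘ V) ∧ ρ (clampM M ∘ V) = ρ W := by
    intro V W hV hW hWM hVW
    have hb : BddMeas (clampM M ∘ V) :=
      ⟨(meas_clampM M).comp hV, M, fun x => abs_clampM hM _⟩
    refine ⟨hb, hLI _ _ hb ⟨hW, M, hWM⟩ ?_⟩
    rw [← Measure.map_map (meas_clampM M) hV, hVW, Measure.map_map (meas_clampM M) hW]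
    congr 1
    ext x
    exact clampM_eq (hWM x)
  have hfst : Measurable (fun z : ℝ × ℝ × Fin (n + 1) => z.1) := by fun_prop
  obtain ⟨hA, hA'⟩ := hclamp (fun ω => (Z ω).1) X (hfst.comp hZ) hX hXM (by
    rw [← hν, ← tripleLaw_map_fst ν r n, ← hZl, Measure.map_map hfst hZ]; rfl)
  have hY : ∀ k : Fin (n + 1), BddMeas (clampM M ∘ (pick k ∘ Z)) ∧
      ρ (clampM M ∘ (pick k ∘ Z)) = ρ X' := fun k =>
    hclamp (pick k ∘ Z) X' ((meas_pick k).comp hZ) hX' hXM' (by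
      rw [← hν', ← hmix k, ← hZl, Measure.map_map (meas_pick k) hZ])
  have hn : (0 : ℝ) < n + 1 := by positivity
  have hconv : (∑ k : Fin (n + 1), ((n : ℝ) + 1)⁻¹ • (clampM M ∘ (pick k ∘ Z))) ∈
      {f : Ω → ℝ | BddMeas f ∧ ρ f ≤ ρ X'} := by
    apply (convex_sublevel hρ (ρ X')).sum_mem
    · intros; positivity
    · simp; field_simp
    · intro k _
      exact ⟨(hY k).1, (hY k).2.le⟩
  rw [← hA']
  refine (rho_lip hρ hA hconv.1 (2 * M / (n + 1)) ?_).trans (by linarith [hconv.2])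
  intro ω
  have hsum : (∑ k : Fin (n + 1), ((n : ℝ) + 1)⁻¹ • (clampM M ∘ (pick k ∘ Z))) ω =
      ((n : ℝ) + 1)⁻¹ * (clampM M (Z ω).2.1 + n * clampM M (Z ω).1) := by
    simp only [Finset.sum_apply, Pi.smul_apply, smul_eq_mul, Function.comp_apply]
    rw [← Finset.mul_sum]
    congr 1
    rw [← Finset.add_sum_erase _ _ (Finset.mem_univ (Z ω).2.2)]
    congr 1
    · simp [pick]
    · rw [Finset.sum_congr rfl (g := fun _ => clampM M (Z ω).1)]
      · rw [Finset.sum_const, Finset.card_erase_of_mem (Finset.mem_univ _), Finset.card_univ,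
          Fintype.card_fin, Nat.add_sub_cancel, nsmul_eq_mul]
      · intro l hl
        have : ¬ (Z ω).2.2 = l := fun h => Finset.ne_of_mem_erase hl h.symm
        simp [pick, this]
  rw [hsum]
  have h1 := abs_le.1 (abs_clampM hM (Z ω).1)
  have h2 := abs_le.1 (abs_clampM hM (Z ω).2.1)
  simp only [Function.comp_apply]
  rw [div_eq_inv_mul, ← mul_add, ← div_eq_inv_mul, le_div_iff₀ hn]
  nlinarith

lemma le_of_singletons {ν ν' : Measure ℤ} (h : ∀ j, ν {j} ≤ ν' {j}) : ν ≤ ν' := by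
  rw [Measure.le_iff]
  intro s hs
  rw [← Measure.tsum_indicator_apply_singleton ν s hs,
    ← Measure.tsum_indicator_apply_singleton ν' s hs]
  apply ENNReal.tsum_le_tsum
  intro j
  exact Set.indicator_le_indicator (h j)

lemma key_index {Ω : Type*} [MeasurableSpace Ω] [StandardBorelSpace Ω]
    (P : Measure Ω) [IsProbabilityMeasure P] [NullSingletonClass P]
    (ρ : (Ω → ℝ) → ℝ) (hρ : IsRiskMeasure P ρ) (hLI : LawInvariant P ρ)
    {E : Type*} [MeasurableSpace E] [StandardBorelSpace E] (μ μ' : Measure E)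
    [IsProbabilityMeasure μ] [IsProbabilityMeasure μ'] (i : E → ℤ) (hi : Measurable i)
    (g : ℤ → ℝ) (M : ℝ) (hM : 0 ≤ M) (hg : ∀ x, |g (i x)| ≤ M) (n : ℕ)
    (h : ∀ j, (n : ℝ≥0∞) * μ (i ⁻¹' {j}) ≤ ((n + 1 : ℕ) : ℝ≥0∞) * μ' (i ⁻¹' {j})) :
    rhoMu P ρ μ (g ∘ i) ≤ rhoMu P ρ μ' (g ∘ i) + 2 * M / (n + 1) := by
  obtain ⟨X, hX, hXl, hXr⟩ := rhoMu_eq P ρ μ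
  obtain ⟨X', hX', hXl', hXr'⟩ := rhoMu_eq P ρ μ'
  have hgm : Measurable g := measurable_of_countable g
  rw [hXr, hXr']
  refine key P ρ hρ hLI _ _ ((hgm.comp hi).comp hX) ((hgm.comp hi).comp hX') M hM
    (fun x => hg _) (fun x => hg _) n ?_
  rw [← Measure.map_map (hgm.comp hi) hX, ← Measure.map_map (hgm.comp hi) hX', hXl, hXl',
    ← Measure.map_map hgm hi, ← Measure.map_map hgm hi, ← Measure.map_smul _ (μ.map i), ← Measure.map_smul _ (μ'.map i)]
  refine Measure.map_mono (le_of_singletons fun j => ?_) hgm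
  simp only [Measure.smul_apply, smul_eq_mul]
  rw [Measure.map_apply hi (measurableSet_singleton j),
    Measure.map_apply hi (measurableSet_singleton j)]
  exact h j

/-- grid index -/
def gidx {E : Type*} (f : E → ℝ) (a ε : ℝ) (x : E) : ℤ := ⌊(f x - a) / ε⌋

def gval (a ε : ℝ) (j : ℤ) : ℝ := a + ε * j

lemma gidx_meas {E : Type*} [MeasurableSpace E] {f : E → ℝ} (hf : Measurable f) (a ε : ℝ) :
    Measurable (gidx f a ε) :=
  Int.measurable_floor.comp ((hf.sub_const a).div_const ε)

lemma grid_le {E : Type*} (f : E → ℝ) (a : ℝ) {ε : ℝ} (hε : 0 < ε) (x : E) :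
    gval a ε (gidx f a ε x) ≤ f x ∧ f x < gval a ε (gidx f a ε x) + ε := by
  unfold gval gidx
  have h1 := Int.floor_le ((f x - a) / ε)
  have h2 := Int.lt_floor_add_one ((f x - a) / ε)
  rw [le_div_iff₀ hε] at h1
  rw [div_lt_iff₀ hε] at h2
  constructor <;> nlinarith

lemma grid_abs {E : Type*} (f : E → ℝ) (a : ℝ) {ε : ℝ} (hε : 0 < ε) {M : ℝ}
    (hM : ∀ x, |f x| ≤ M) (x : E) : |gval a ε (gidx f a ε x)| ≤ M + ε := by
  have := grid_le f a hε x
  have := abs_le.1 (hM x)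
  rw [abs_le]
  constructor <;> linarith

lemma gidx_empty {E : Type*} (f : E → ℝ) (a : ℝ) {ε : ℝ} (hε : 0 < ε) {M : ℝ}
    (hM : ∀ x, |f x| ≤ M) (j : ℤ) (hj : j ∉ Finset.Icc ⌊(-M - a) / ε⌋ ⌊(M - a) / ε⌋) :
    gidx f a ε ⁻¹' {j} = ∅ := by
  ext x
  simp only [Set.mem_preimage, Set.mem_singleton_iff, Set.mem_empty_iff_false, iff_false]
  intro hx
  apply hj
  rw [← hx, Finset.mem_Icc]
  have := abs_le.1 (hM x)
  unfold gidx
  constructor <;> apply Int.floor_le_floor <;> gcongr <;> linarith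

lemma rhoMu_grid {Ω : Type*} [MeasurableSpace Ω] [StandardBorelSpace Ω]
    (P : Measure Ω) [IsProbabilityMeasure P] [NullSingletonClass P]
    (ρ : (Ω → ℝ) → ℝ) (hρ : IsRiskMeasure P ρ)
    {E : Type*} [MeasurableSpace E] [StandardBorelSpace E] (μ : Measure E)
    [IsProbabilityMeasure μ] {f : E → ℝ} (hf : BddMeas f) (a : ℝ) {ε : ℝ} (hε : 0 < ε) :
    rhoMu P ρ μ (gval a ε ∘ gidx f a ε) ≤ rhoMu P ρ μ f ∧
    rhoMu P ρ μ f ≤ rhoMu P ρ μ (gval a ε ∘ gidx f a ε) + ε := by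
  obtain ⟨X, hX, hXl, hXr⟩ := rhoMu_eq P ρ μ
  rw [hXr, hXr]
  obtain ⟨M, hM⟩ := hf.2
  have hb : BddMeas (gval a ε ∘ gidx f a ε) :=
    ⟨(measurable_of_countable _).comp (gidx_meas hf.1 a ε), M + ε, grid_abs f a hε hM⟩
  constructor
  · have := rho_lip hρ (hb.comp' hX) (hf.comp' hX) 0 (fun x => by
      simpa using (grid_le f a hε (X x)).1)
    simpa using this
  · exact rho_lip hρ (hf.comp' hX) (hb.comp' hX) ε (fun x => (grid_le f a hε (X x)).2.le)

lemma lsc_open {E : Type*} [TopologicalSpace E] [MeasurableSpace E] [PolishSpace E] [BorelSpace E]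
    {G : Set E} (hG : IsOpen G) :
    LowerSemicontinuous (fun μ : ProbabilityMeasure E => (μ : Measure E) G) := by
  letI := TopologicalSpace.upgradeIsCompletelyMetrizable E
  rw [lowerSemicontinuous_iff_le_liminf]
  intro μ
  exact ProbabilityMeasure.le_liminf_measure_open_of_tendsto tendsto_id hG

lemma meas_eval {E : Type*} [TopologicalSpace E] [MeasurableSpace E] [PolishSpace E] [BorelSpace E]
    {B : Set E} (hB : MeasurableSet B) :
    @Measurable (ProbabilityMeasure E) ℝ≥0∞ (borel (ProbabilityMeasure E)) inferInstance
      (fun μ => (μ : Measure E) B) := by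
  letI : MeasurableSpace (ProbabilityMeasure E) := borel _
  haveI : BorelSpace (ProbabilityMeasure E) := ⟨rfl⟩
  have : Measurable (fun μ : ProbabilityMeasure E => (μ : Measure E)) := by
    refine Measurable.measure_of_isPiSystem_of_isProbabilityMeasure
      (BorelSpace.measurable_eq (α := E)) isPiSystem_isOpen ?_
    intro s hs
    exact (lsc_open hs).measurable
  exact (Measure.measurable_coe hB).comp this

lemma meas_simple {Ω : Type*} [MeasurableSpace Ω] [StandardBorelSpace Ω]
    (P : Measure Ω) [IsProbabilityMeasure P] [NullSingletonClass P]
    (ρ : (Ω → ℝ) → ℝ) (hρ : IsRiskMeasure P ρ) (hLI : LawInvariant P ρ)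
    {E : Type*} [TopologicalSpace E] [MeasurableSpace E] [PolishSpace E] [BorelSpace E]
    (i : E → ℤ) (hi : Measurable i)
    (g : ℤ → ℝ) (M : ℝ) (hM : 0 ≤ M) (hg : ∀ x, |g (i x)| ≤ M) (J : Finset ℤ)
    (hJ : ∀ j ∉ J, i ⁻¹' {j} = ∅) :
    @Measurable (ProbabilityMeasure E) ℝ (borel (ProbabilityMeasure E)) inferInstance
      (fun μ => rhoMu P ρ (μ : Measure E) (g ∘ i)) := by
  letI : MeasurableSpace (ProbabilityMeasure E) := borel _
  haveI : BorelSpace (ProbabilityMeasure E) := ⟨rfl⟩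
  apply measurable_of_Ioi
  intro a
  let T : ProbabilityMeasure E → (ℤ → ℝ≥0∞) := fun μ j => (μ : Measure E) (i ⁻¹' {j})
  have hT : Measurable T :=
    measurable_pi_lambda _ fun j => meas_eval (hi (measurableSet_singleton j))
  let O : Set (ℤ → ℝ≥0∞) := ⋃ (μ₀ : ProbabilityMeasure E) (n : ℕ)
    (_ : a < rhoMu P ρ (μ₀ : Measure E) (g ∘ i) - 2 * M / (n + 1)),
      ⋂ j ∈ J, {v | (n : ℝ≥0∞) * T μ₀ j < ((n + 1 : ℕ) : ℝ≥0∞) * v j ∨ T μ₀ j = 0}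
  have hO : IsOpen O := by
    refine isOpen_iUnion fun μ₀ => isOpen_iUnion fun n => isOpen_iUnion fun _ => ?_
    refine isOpen_biInter_finset fun j _ => ?_
    by_cases h0 : T μ₀ j = 0
    · simp [h0]
    · simp only [h0, or_false]
      exact isOpen_lt continuous_const
        ((ENNReal.continuous_const_mul (ENNReal.natCast_ne_top _)).comp (continuous_apply j))
  have heq : (fun μ : ProbabilityMeasure E => rhoMu P ρ (μ : Measure E) (g ∘ i)) ⁻¹' Set.Ioi a
      = T ⁻¹' O := by
    ext μ
    simp only [Set.mem_preimage, Set.mem_Ioi, O, Set.mem_iUnion, Set.mem_iInter,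
      Set.mem_ofPred_eq, exists_prop]
    constructor
    · intro h
      have ht : Tendsto (fun n : ℕ => rhoMu P ρ (μ : Measure E) (g ∘ i) - 2 * M / ((n : ℝ) + 1))
          atTop (𝓝 (rhoMu P ρ (μ : Measure E) (g ∘ i) - 0)) := by
        refine tendsto_const_nhds.sub ?_
        have := (tendsto_one_div_add_atTop_nhds_zero_nat (𝕜 := ℝ)).const_mul (2 * M)
        simpa [div_eq_mul_inv] using this
      rw [sub_zero] at ht
      obtain ⟨n, hn⟩ := (ht.eventually (lt_mem_nhds h)).exists
      refine ⟨μ, n, hn, fun j _ => ?_⟩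
      by_cases h0 : T μ j = 0
      · exact Or.inr h0
      · left
        refine ENNReal.mul_lt_mul_left h0 (measure_ne_top _ _) ?_
        exact_mod_cast Nat.lt_succ_self n
    · rintro ⟨μ₀, n, hn, hj⟩
      have := key_index P ρ hρ hLI (μ₀ : Measure E) (μ : Measure E) i hi g M hM hg n (by
        intro j
        by_cases hjJ : j ∈ J
        · rcases hj j hjJ with h | h
          · exact h.le
          · have h' : (μ₀ : Measure E) (i ⁻¹' {j}) = 0 := h
            rw [h']; simp
        · rw [hJ j hjJ]; simp)
      linarith
  rw [heq]
  exact hT hO.measurableSet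

lemma exists_good {E : Type*} [MeasurableSpace E] (μ : Measure E) [IsProbabilityMeasure μ]
    {f : E → ℝ} (hf : Measurable f) (ε : ℝ) :
    ∃ a : ℝ, ∀ j : ℤ, μ {x | f x = a + ε * j} = 0 := by
  have hc := Measure.countable_meas_level_set_pos (μ := μ) hf
  have hc2 : (⋃ j : ℤ, (fun t : ℝ => t - ε * j) '' {t : ℝ | 0 < μ {x | f x = t}}).Countable :=
    Set.countable_iUnion fun j => hc.image _
  obtain ⟨a, ha⟩ : ∃ a, a ∉ (⋃ j : ℤ, (fun t : ℝ => t - ε * j) '' {t : ℝ | 0 < μ {x | f x = t}}) := by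
    by_contra h
    push Not at h
    exact Cardinal.not_countable_real (hc2.mono fun x _ => h x)
  refine ⟨a, fun j => ?_⟩
  by_contra h
  apply ha
  rw [Set.mem_iUnion]
  exact ⟨j, a + ε * j, pos_iff_ne_zero.2 h, by simp⟩

lemma lsc_main {Ω : Type*} [MeasurableSpace Ω] [StandardBorelSpace Ω]
    (P : Measure Ω) [IsProbabilityMeasure P] [NullSingletonClass P]
    (ρ : (Ω → ℝ) → ℝ) (hρ : IsRiskMeasure P ρ) (hLI : LawInvariant P ρ)
    {E : Type*} [TopologicalSpace E] [MeasurableSpace E] [PolishSpace E] [BorelSpace E]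
    {f : E → ℝ} (hf : BddMeas f) (hc : Continuous f) :
    LowerSemicontinuous (fun μ : ProbabilityMeasure E => rhoMu P ρ (μ : Measure E) f) := by
  intro μ b hb
  obtain ⟨M, hM⟩ := hf.2
  simp only at hb
  obtain ⟨ε, hε, hεb⟩ : ∃ ε : ℝ, 0 < ε ∧ b < rhoMu P ρ (μ : Measure E) f - 2 * ε :=
    ⟨(rhoMu P ρ (μ : Measure E) f - b) / 4, by linarith, by linarith⟩
  haveI : Nonempty E := nonempty_of_isProbabilityMeasure (μ : Measure E)
  have hM0 : 0 ≤ M := (abs_nonneg _).trans (hM (Classical.arbitrary E))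
  obtain ⟨a, ha⟩ := exists_good (μ : Measure E) hf.1 ε
  obtain ⟨n, hn⟩ : ∃ n : ℕ, 2 * (M + ε) / ((n : ℝ) + 1) < ε := by
    have := (tendsto_one_div_add_atTop_nhds_zero_nat (𝕜 := ℝ)).const_mul (2 * (M + ε))
    rw [mul_zero] at this
    obtain ⟨n, hn⟩ := (this.eventually (gt_mem_nhds hε)).exists
    exact ⟨n, by simpa [div_eq_mul_inv] using hn⟩
  let i := gidx f a ε
  have hi : Measurable i := gidx_meas hf.1 a ε
  let G : ℤ → Set E := fun j => f ⁻¹' Set.Ioo (a + ε * j) (a + ε * j + ε)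
  have hGo : ∀ j, IsOpen (G j) := fun j => isOpen_Ioo.preimage hc
  have hGi : ∀ j, G j ⊆ i ⁻¹' {j} := by
    intro j x hx
    have h1 : a + ε * j < f x := hx.1
    have h2 : f x < a + ε * j + ε := hx.2
    change ⌊(f x - a) / ε⌋ = j
    rw [Int.floor_eq_iff, le_div_iff₀ hε, div_lt_iff₀ hε]
    constructor <;> nlinarith
  have hGm : ∀ j, (μ : Measure E) (i ⁻¹' {j}) ≤ (μ : Measure E) (G j) := by
    intro j
    have : i ⁻¹' {j} ⊆ G j ∪ {x | f x = a + ε * j} := by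
      intro x hx
      have hx' : gidx f a ε x = j := hx
      have := grid_le f a hε x
      rw [hx'] at this
      rcases eq_or_lt_of_le this.1 with h | h
      · right; exact h.symm
      · left; exact ⟨h, this.2⟩
    refine (measure_mono this).trans ((measure_union_le _ _).trans ?_)
    rw [ha j, add_zero]
  have hev : ∀ᶠ μ' : ProbabilityMeasure E in 𝓝 μ,
      ∀ j ∈ Finset.Icc ⌊(-M - a) / ε⌋ ⌊(M - a) / ε⌋,
      (n : ℝ≥0∞) * (μ : Measure E) (i ⁻¹' {j}) ≤
        ((n + 1 : ℕ) : ℝ≥0∞) * (μ' : Measure E) (i ⁻¹' {j}) := by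
    rw [Filter.eventually_all_finset]
    intro j _
    by_cases h0 : (μ : Measure E) (G j) = 0
    · have h0' : (μ : Measure E) (i ⁻¹' {j}) = 0 := le_antisymm ((hGm j).trans h0.le) zero_le
      refine Eventually.of_forall fun μ' => ?_
      rw [h0']; simp
    · have hlt : (n : ℝ≥0∞) * (μ : Measure E) (G j) / ((n + 1 : ℕ) : ℝ≥0∞) <
          (μ : Measure E) (G j) := by
        rw [ENNReal.div_lt_iff (by simp) (by simp), mul_comm]
        refine ENNReal.mul_lt_mul_right h0 (measure_ne_top _ _) ?_
        exact_mod_cast Nat.lt_succ_self n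
      filter_upwards [lsc_open (hGo j) μ _ hlt] with μ' hμ'
      rw [gt_iff_lt, ENNReal.div_lt_iff (by simp) (by simp), mul_comm _ ((n + 1 : ℕ) : ℝ≥0∞)] at hμ'
      calc (n : ℝ≥0∞) * (μ : Measure E) (i ⁻¹' {j}) ≤ n * (μ : Measure E) (G j) := by
            exact mul_le_mul_right (hGm j) _
        _ ≤ ((n + 1 : ℕ) : ℝ≥0∞) * (μ' : Measure E) (G j) := hμ'.le
        _ ≤ _ := by gcongr; exact hGi j
  filter_upwards [hev] with μ' hμ'
  have h1 := key_index P ρ hρ hLI (μ : Measure E) (μ' : Measure E) i hi (gval a ε) (M + ε)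
    (by linarith) (grid_abs f a hε hM) n (by
      intro j
      by_cases hj : j ∈ Finset.Icc ⌊(-M - a) / ε⌋ ⌊(M - a) / ε⌋
      · exact hμ' j hj
      · have : i ⁻¹' {j} = ∅ := gidx_empty f a hε hM j hj
        rw [this]; simp)
  have h2 := rhoMu_grid P ρ hρ (μ : Measure E) hf a hε
  have h3 := rhoMu_grid P ρ hρ (μ' : Measure E) hf a hε
  change b < rhoMu P ρ (μ' : Measure E) f
  change rhoMu P ρ (μ : Measure E) (gval a ε ∘ gidx f a ε) ≤
    rhoMu P ρ (μ' : Measure E) (gval a ε ∘ gidx f a ε) + _ at h1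
  linarith [h2.2, h3.1]

/-- For a law invariant risk measure `ρ`, a Polish space `E` and a bounded
measurable `f : E → ℝ`, the map `Φ(μ) := ρ_μ(f)` is Borel measurable on `𝓟(E)` (with the Borel
σ-field of the topology of weak convergence); if moreover `f` is continuous, `Φ` is lower
semicontinuous. -/
theorem statement4 {Ω : Type*} [MeasurableSpace Ω] [StandardBorelSpace Ω]
    (P : Measure Ω) [IsProbabilityMeasure P] [NullSingletonClass P]
    (ρ : (Ω → ℝ) → ℝ) (hρ : IsRiskMeasure P ρ) (hLI : LawInvariant P ρ)
    (E : Type) [TopologicalSpace E] [MeasurableSpace E] [PolishSpace E] [BorelSpace E]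
    (f : E → ℝ) (hf : BddMeas f) :
    (@Measurable (ProbabilityMeasure E) ℝ (borel (ProbabilityMeasure E)) inferInstance
      (fun μ => rhoMu P ρ (μ : Measure E) f)) ∧
    (Continuous f →
      LowerSemicontinuous (fun μ : ProbabilityMeasure E => rhoMu P ρ (μ : Measure E) f)) := by
  refine ⟨?_, lsc_main P ρ hρ hLI hf⟩
  letI : MeasurableSpace (ProbabilityMeasure E) := borel _
  haveI : BorelSpace (ProbabilityMeasure E) := ⟨rfl⟩
  obtain ⟨M, hM⟩ := hf.2
  have hM' : ∀ x, |f x| ≤ |M| := fun x => (hM x).trans (le_abs_self M)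
  have hpos : ∀ n : ℕ, (0 : ℝ) < 1 / ((n : ℝ) + 1) := fun n => by positivity
  refine measurable_of_tendsto_metrizable
    (f := fun (n : ℕ) (μ : ProbabilityMeasure E) =>
      rhoMu P ρ (μ : Measure E) (gval 0 (1 / ((n : ℝ) + 1)) ∘ gidx f 0 (1 / ((n : ℝ) + 1)))) ?_ ?_
  · intro n
    exact meas_simple P ρ hρ hLI _ (gidx_meas hf.1 _ _) _ (|M| + 1 / ((n : ℝ) + 1))
      (add_nonneg (abs_nonneg M) (hpos n).le) (grid_abs f 0 (hpos n) hM') _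
      (gidx_empty f 0 (hpos n) hM')
  · rw [tendsto_pi_nhds]
    intro μ
    have ht : Tendsto (fun n : ℕ => rhoMu P ρ (μ : Measure E) f - 1 / ((n : ℝ) + 1)) atTop
        (𝓝 (rhoMu P ρ (μ : Measure E) f)) := by
      simpa using tendsto_const_nhds.sub (tendsto_one_div_add_atTop_nhds_zero_nat (𝕜 := ℝ))
    refine tendsto_of_tendsto_of_tendsto_of_le_of_le ht tendsto_const_nhds ?_ ?_
    · intro n
      have := (rhoMu_grid P ρ hρ (μ : Measure E) hf 0 (hpos n)).2
      simp only
      linarith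
    · intro n
      exact (rhoMu_grid P ρ hρ (μ : Measure E) hf 0 (hpos n)).1

end RiskDiv
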